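/- arXiv:2004.12110 — 2 statements merged into one kernel-verified Lean document; each statement's English description precedes it below -/
import Mathlib

section
/- Let L be a finite-dimensional (right) Leibniz algebra over a field F of characteristic zero such that the centralizer C_L(x) is a two-sided ideal of L for every x ∈ L. Then L is solvable. -/
/-- The derived series of an algebra: `derSeries br 0 = L` and
`derSeries br (k+1) = span {[u,v] | u, v ∈ derSeries br k}`. -/
def derSeries {F L : Type*} [Field F] [AddCommGroup L] [Module F L]
    (br : L →ₗ[F] L →ₗ[F] L) : ℕ → Submodule F L
  | 0 => ⊤
  | k + 1 => Submodule.span F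
      {w : L | ∃ u ∈ derSeries br k, ∃ v ∈ derSeries br k, w = br u v}

universe u

open Module in
theorem exists_casimir_family {F g : Type*} [Field F] [LieRing g] [LieAlgebra F g]
    [FiniteDimensional F g] (τ : LinearMap.BilinForm F g) (hτ : τ.Nondegenerate)
    (hsymm : τ.IsSymm) (hinv : ∀ x y z : g, τ ⁅x, y⁆ z = τ x ⁅y, z⁆)
    (Q : Type*) [AddCommGroup Q] [Module F Q] [LieRingModule g Q] [LieModule F g Q] :
    ∃ e e' : Fin (finrank F g) → g, (∀ i, τ (e i) (e' i) = 1) ∧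
      ∀ (x : g) (q : Q), ∑ i, ⁅e i, ⁅e' i, ⁅x, q⁆⁆⁆ = ⁅x, ∑ i, ⁅e i, ⁅e' i, q⁆⁆⁆ := by
  classical
  let b := finBasis F g
  let d := τ.dualBasis hτ b
  refine ⟨b, d, fun i ↦ by simp [d, LinearMap.BilinForm.apply_dualBasis_right hτ hsymm], ?_⟩
  intro x q
  have hb (i) : ⁅x, b i⁆ = ∑ j, τ (d j) ⁅x, b i⁆ • b j := by
    conv_lhs => rw [← b.sum_repr ⁅x, b i⁆]
    refine Finset.sum_congr rfl fun j _ ↦ ?_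
    congr 1
    conv_rhs => rw [← b.sum_repr ⁅x, b i⁆]
    simp only [map_sum, map_smul, d, LinearMap.BilinForm.apply_dualBasis_left]
    simp
  have hd (i) : ⁅x, d i⁆ = ∑ j, τ ⁅x, d i⁆ (b j) • d j := by
    conv_lhs => rw [← d.sum_repr ⁅x, d i⁆]
    refine Finset.sum_congr rfl fun j _ ↦ ?_
    rw [LinearMap.BilinForm.dualBasis_repr_apply]
  have hskew (i j) : τ ⁅x, d j⁆ (b i) = - τ (d j) ⁅x, b i⁆ := by
    rw [← lie_skew, map_neg, LinearMap.neg_apply, hinv]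
  have h1 : ∑ i, ⁅⁅x, b i⁆, ⁅d i, q⁆⁆ = ∑ i, ∑ j, τ (d j) ⁅x, b i⁆ • ⁅b j, ⁅d i, q⁆⁆ := by
    refine Finset.sum_congr rfl fun i _ ↦ ?_
    conv_lhs => rw [hb i]
    simp [sum_lie]
  have h2 : ∑ i, ⁅b i, ⁅⁅x, d i⁆, q⁆⁆ = - ∑ i, ∑ j, τ (d j) ⁅x, b i⁆ • ⁅b j, ⁅d i, q⁆⁆ := by
    rw [Finset.sum_comm, ← Finset.sum_neg_distrib]
    refine Finset.sum_congr rfl fun i _ ↦ ?_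
    conv_lhs => rw [hd i]
    simp [sum_lie, lie_sum, hskew]
  have h3 : ∀ i, ⁅x, ⁅b i, ⁅d i, q⁆⁆⁆ =
      ⁅⁅x, b i⁆, ⁅d i, q⁆⁆ + ⁅b i, ⁅⁅x, d i⁆, q⁆⁆ + ⁅b i, ⁅d i, ⁅x, q⁆⁆⁆ := by
    intro i
    rw [leibniz_lie x (b i), leibniz_lie x (d i), lie_add, add_assoc]
  simp only [lie_sum, h3, Finset.sum_add_distrib, h1, h2]
  simp

theorem lie_mem_of_forall_lie_lie_mem {F g Q : Type*} [CommRing F] [LieRing g] [LieAlgebra F g]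
    [AddCommGroup Q] [Module F Q] [LieRingModule g Q] [LieModule F g Q]
    (hperf : ⁅(⊤ : LieIdeal F g), (⊤ : LieIdeal F g)⁆ = ⊤) (N : LieSubmodule F g Q) (q : Q)
    (h : ∀ x y : g, ⁅x, ⁅y, q⁆⁆ ∈ N) (x : g) : ⁅x, q⁆ ∈ N := by
  have hx : x ∈ (⁅(⊤ : LieIdeal F g), (⊤ : LieIdeal F g)⁆).toSubmodule := by simp [hperf]
  rw [LieSubmodule.lieIdeal_oper_eq_linear_span'] at hx
  induction hx using Submodule.span_induction with
  | mem x hx =>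
    obtain ⟨y, -, z, -, rfl⟩ := hx
    rw [lie_lie]
    exact sub_mem (h _ _) (h _ _)
  | zero => simp
  | add a b _ _ ha hb => rw [add_lie]; exact add_mem ha hb
  | smul t a _ ha => rw [smul_lie]; exact N.smul_mem t ha

open Module in
theorem exists_add_mem_forall_lie_eq_zero {F g Q : Type*} [Field F] [CharZero F] [LieRing g]
    [LieAlgebra F g] [FiniteDimensional F g] [AddCommGroup Q] [Module F Q]
    [FiniteDimensional F Q] [LieRingModule g Q] [LieModule F g Q]
    (hperf : ⁅(⊤ : LieIdeal F g), (⊤ : LieIdeal F g)⁆ = ⊤)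
    (hsimple : ∀ I : LieIdeal F g, I = ⊥ ∨ I = ⊤)
    (V : LieSubmodule F g Q) (w : Q) (hw : ∀ x : g, ⁅x, w⁆ ∈ V) :
    ∃ v ∈ V, ∀ x : g, ⁅x, w + v⁆ = 0 := by
  induction hn : finrank F V using Nat.strong_induction_on generalizing V w with
  | _ n ih =>
  by_cases hτ : LieModule.traceForm F g V = 0
  · have hnil : LieModule.IsNilpotent g V := by
      have := LieModule.isNilpotent_derivedSeries_of_traceForm_eq_zero hτ
      rw [LieModule.isNilpotent_iff_forall' (R := F)] at this ⊢
      intro x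
      exact this ⟨x, by simp [hperf]⟩
    have hV (k : ℕ) (x : g) (v : V) : ⁅x, v⁆ ∈ LieModule.lowerCentralSeries F g V k := by
      induction k generalizing x v with
      | zero => simp
      | succ k ihk =>
        refine lie_mem_of_forall_lie_lie_mem hperf _ v (fun y z ↦ ?_) x
        rw [LieModule.lowerCentralSeries_succ]
        exact LieSubmodule.lie_mem_lie (LieSubmodule.mem_top y) (ihk z v)
    obtain ⟨k, hk⟩ := (LieModule.isNilpotent_iff F g V).1 hnil
    refine ⟨0, zero_mem _, fun x ↦ ?_⟩
    rw [add_zero]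
    refine (LieSubmodule.mem_bot _).1 (lie_mem_of_forall_lie_lie_mem (F := F) hperf ⊥ w
      (fun y z ↦ ?_) x)
    have := hV k y ⟨_, hw z⟩
    rw [hk, LieSubmodule.mem_bot] at this
    exact congrArg Subtype.val this
  · have hker : LinearMap.ker (LieModule.traceForm F g V) = ⊥ := by
      let I : LieIdeal F g :=
        { LinearMap.ker (LieModule.traceForm F g V) with
          lie_mem := by
            intro x y hy
            simp only [AddSubsemigroup.mem_carrier, AddSubmonoid.mem_toSubsemigroup,
              Submodule.mem_toAddSubmonoid, LinearMap.mem_ker] at hy ⊢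
            ext z
            rw [← lie_skew, map_neg, LinearMap.neg_apply,
              LieModule.traceForm_apply_lie_apply, hy]
            simp }
      rcases hsimple I with h | h
      · have := congrArg LieSubmodule.toSubmodule h
        simpa [I] using this
      · have := congrArg LieSubmodule.toSubmodule h
        exact absurd (LinearMap.ker_eq_top.1 (by simpa [I] using this)) hτ
    obtain ⟨e, e', h1, hcomm⟩ := exists_casimir_family (LieModule.traceForm F g V)
      (LinearMap.BilinForm.nondegenerate_iff_ker_eq_bot.2 hker)
      ⟨LieModule.traceForm_comm F g V⟩ (LieModule.traceForm_apply_lie_apply F g V) Q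
    let c : End F Q := ∑ i, LieModule.toEnd F g Q (e i) * LieModule.toEnd F g Q (e' i)
    have hc (q : Q) : c q = ∑ i, ⁅e i, ⁅e' i, q⁆⁆ := by simp [c]
    have hcx (k : ℕ) (x : g) (q : Q) : (c ^ k) ⁅x, q⁆ = ⁅x, (c ^ k) q⁆ := by
      induction k with
      | zero => simp
      | succ k ihk => rw [pow_succ', End.mul_apply, ihk, hc, hcomm, ← hc, End.mul_apply]
    have hcV (q : Q) (hq : q ∈ V) : c q ∈ V := by
      rw [hc]
      exact sum_mem fun i _ ↦ V.lie_mem (V.lie_mem hq)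
    have hcw : c w ∈ V := by
      rw [hc]
      exact sum_mem fun i _ ↦ V.lie_mem (hw _)
    let cV : End F V := c.restrict (p := V.toSubmodule) (q := V.toSubmodule) hcV
    have hcVk (k : ℕ) (v : V) : ((cV ^ k) v : Q) = (c ^ k) v := by
      induction k with
      | zero => simp
      | succ k ihk => 
        rw [pow_succ', End.mul_apply, pow_succ', End.mul_apply, ← ihk]
        rfl
    have htr : LinearMap.trace F V cV = finrank F g := by
      have : cV = ∑ i, LieModule.toEnd F g V (e i) * LieModule.toEnd F g V (e' i) := by
        ext v
        change c v = _
        simp [hc]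
      rw [this, map_sum]
      have (i : Fin (finrank F g)) : LinearMap.trace F V (LieModule.toEnd F g V (e i) * LieModule.toEnd F g V (e' i))
        = 1 := h1 i
      simp [this]
    have hg : (finrank F g : F) ≠ 0 := by
      intro h0
      have : Subsingleton g := by
        rw [← finrank_zero_iff (R := F)]
        exact_mod_cast h0
      exact hτ (by ext x; simp [Subsingleton.elim x 0])
    obtain ⟨k, hk⟩ := Filter.eventually_atTop.1 (LinearMap.eventually_iInf_range_pow_eq cV)
    have hrange : LinearMap.range (cV ^ (k + 1)) = LinearMap.range (cV ^ (k + 1 + (k + 1))) :=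
      (hk _ (by omega)).symm.trans (hk _ (by omega))
    have hwk : (c ^ (k + 1)) w ∈ V := by
      rw [pow_succ, End.mul_apply, ← hcVk k ⟨_, hcw⟩]
      exact SetLike.coe_mem _
    obtain ⟨v, hv⟩ : (cV ^ (k + 1)) ⟨_, hwk⟩ ∈ LinearMap.range (cV ^ (k + 1 + (k + 1))) :=
      hrange ▸ LinearMap.mem_range_self _ _
    replace hv : (c ^ (k + 1 + (k + 1))) (w - v) = 0 := by
      have := congrArg (Subtype.val) hv
      rw [hcVk, hcVk] at this
      rw [map_sub, this, pow_add, End.mul_apply, sub_self]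
    let N := k + 1 + (k + 1)
    let V' : LieSubmodule F g Q :=
      { V.toSubmodule ⊓ LinearMap.ker (c ^ N) with
        lie_mem := by
          rintro x q ⟨hq, hq'⟩
          refine ⟨V.lie_mem hq, ?_⟩
          replace hq' : (c ^ N) q = 0 := hq'
          change (c ^ N) ⁅x, q⁆ = 0
          rw [hcx, hq', lie_zero] }
    have hV' (q : Q) : q ∈ V' ↔ q ∈ V ∧ (c ^ N) q = 0 := Iff.rfl
    have hlt : V'.toSubmodule < V.toSubmodule := by
      refine lt_of_le_of_ne inf_le_left fun h ↦ hg ?_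
      rw [← htr]
      refine (LinearMap.isNilpotent_trace_of_isNilpotent ⟨N, ?_⟩).eq_zero
      ext v
      rw [hcVk]
      exact ((hV' v).1 (h.symm ▸ v.2 : (v : Q) ∈ V'.toSubmodule)).2
    obtain ⟨v', hv', hv'x⟩ := ih _ (hn ▸ Submodule.finrank_lt_finrank_of_lt hlt) V' (w - v)
      (fun x ↦ (hV' _).2 ⟨by
        rw [lie_sub]; exact sub_mem (hw x) (V.lie_mem v.2), by rw [hcx, hv, lie_zero]⟩) rfl
    refine ⟨v' - v, sub_mem ((hV' _).1 hv').1 v.2, fun x ↦ ?_⟩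
    rw [← hv'x x]
    congr 1
    abel

/-- `br` is the bracket of a Lie algebra without proper nonzero ideals that is equal to its
derived subalgebra. -/
structure IsSimpleLieBracket {F S : Type*} [Field F] [AddCommGroup S] [Module F S]
    (br : S →ₗ[F] S →ₗ[F] S) : Prop where
  leibniz : ∀ x y z : S, br x (br y z) = br (br x y) z - br (br x z) y
  self : ∀ x : S, br x x = 0
  perfect : Submodule.map₂ br ⊤ ⊤ = ⊤
  nontrivial : Nontrivial S
  simple : ∀ J : Submodule F S, (∀ a ∈ J, ∀ x, br a x ∈ J) → J = ⊥ ∨ J = ⊤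

theorem apply_eq_neg_apply_of_self_eq_zero {F S : Type*} [Field F] [AddCommGroup S] [Module F S]
    {br : S →ₗ[F] S →ₗ[F] S} (h : ∀ x, br x x = 0) (x y : S) : br x y = - br y x := by
  have := h (x + y)
  simp only [map_add, LinearMap.add_apply, h, zero_add, add_zero] at this
  rw [eq_neg_iff_add_eq_zero, add_comm, this]

theorem IsSimpleLieBracket.exists_invariant {F S Q : Type*} [Field F] [CharZero F]
    [AddCommGroup S] [Module F S] [FiniteDimensional F S] [AddCommGroup Q] [Module F Q]
    [FiniteDimensional F Q] {br : S →ₗ[F] S →ₗ[F] S} (h : IsSimpleLieBracket br)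
    (ρ : S →ₗ[F] Module.End F Q) (hρ : ∀ x y, ρ (br x y) = ρ x * ρ y - ρ y * ρ x)
    (V : Submodule F Q) (hV : ∀ x, ∀ v ∈ V, ρ x v ∈ V) (w : Q) (hw : ∀ x, ρ x w ∈ V) :
    ∃ v ∈ V, ∀ x, ρ x (w + v) = 0 := by
  let _ : LieRing S :=
    { bracket := fun x y ↦ br x y
      add_lie := by intro x y z; change br (x + y) z = br x z + br y z; simp
      lie_add := by intro x y z; change br x (y + z) = br x y + br x z; simp
      lie_self := h.self
      leibniz_lie := by
        intro x y z
        change br x (br y z) = br (br x y) z + br y (br x z)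
        rw [h.leibniz, apply_eq_neg_apply_of_self_eq_zero h.self y (br x z), sub_eq_add_neg] }
  let _ : LieAlgebra F S :=
    { lie_smul := by intro t x y; change br x (t • y) = t • br x y; simp }
  let _ : LieRingModule S Q :=
    { bracket := fun x q ↦ ρ x q
      add_lie := by intro x y q; change ρ (x + y) q = ρ x q + ρ y q; simp
      lie_add := by intro x p q; exact map_add (ρ x) p q
      leibniz_lie := by
        intro x y q
        change ρ x (ρ y q) = ρ (br x y) q + ρ y (ρ x q)
        simp [hρ] }
  let _ : LieModule F S Q :=
    { smul_lie := by intro t x q; change ρ (t • x) q = t • ρ x q; simp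
      lie_smul := by intro t x q; change ρ x (t • q) = t • ρ x q; simp }
  refine exists_add_mem_forall_lie_eq_zero (F := F) (g := S) ?_ ?_
    { V with lie_mem := fun {x v} hv ↦ hV x v hv } w hw
  · have hle : Submodule.map₂ br ⊤ ⊤ ≤
        (⁅(⊤ : LieIdeal F S), (⊤ : LieIdeal F S)⁆).toSubmodule :=
      Submodule.map₂_le.2 fun x _ y _ ↦
        LieSubmodule.lie_mem_lie (LieSubmodule.mem_top x) (LieSubmodule.mem_top y)
    rw [h.perfect, top_le_iff] at hle
    simpa using hle
  · intro I
    have := h.simple I.toSubmodule fun a ha x ↦ by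
      rw [apply_eq_neg_apply_of_self_eq_zero h.self]
      exact neg_mem (I.lie_mem ha)
    simpa using this

theorem IsSimpleLieBracket.exists_invariant_mod {F L S E : Type*} [Field F] [CharZero F]
    [AddCommGroup L] [Module F L] [AddCommGroup S] [Module F S] [FiniteDimensional F S]
    [AddCommGroup E] [Module F E] [FiniteDimensional F E]
    {br : L →ₗ[F] L →ₗ[F] L} {brS : S →ₗ[F] S →ₗ[F] S} (h : IsSimpleLieBracket brS)
    (π : L →ₗ[F] S) (hsurj : Function.Surjective π) (hπ : ∀ x y, π (br x y) = brS (π x) (π y))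
    (D : L →ₗ[F] Module.End F E) (hD : ∀ x y, D (br x y) = D x * D y - D y * D x)
    (U V : Submodule F E) (hU : ∀ x, ∀ u ∈ U, D x u ∈ U) (hV : ∀ x, ∀ v ∈ V, D x v ∈ V)
    (hVU : ∀ x, π x = 0 → ∀ v ∈ V, D x v ∈ U) (w : E) (hw : ∀ x, D x w ∈ V)
    (hwU : ∀ x, π x = 0 → D x w ∈ U) :
    ∃ v ∈ V, ∀ x, D x (w + v) ∈ U := by
  let W : Submodule F E := V ⊔ F ∙ w
  have hVW : V ≤ W := le_sup_left
  have hwW : w ∈ W := le_sup_right (a := V) (Submodule.mem_span_singleton_self w)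
  have hWV (x) : W ≤ V.comap (D x) :=
    sup_le (hV x) ((Submodule.span_singleton_le_iff_mem _ _).2 (hw x))
  have hWU (x) (hx : π x = 0) : W ≤ U.comap (D x) :=
    sup_le (hVU x hx) ((Submodule.span_singleton_le_iff_mem _ _).2 (hwU x hx))
  let U' : Submodule F W := U.comap W.subtype
  have hWW (x) : ∀ q ∈ W, D x q ∈ W := fun q hq ↦ hVW (hWV x hq)
  have hUU (x) : U' ≤ U'.comap ((D x).restrict (hWW x)) := fun u hu ↦ hU x _ hu
  let ρ : L →ₗ[F] Module.End F (W ⧸ U') :=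
    { toFun := fun x ↦ U'.mapQ U' ((D x).restrict (hWW x)) (hUU x)
      map_add' := by
        intro x y
        ext q
        simp only [LinearMap.comp_apply, Submodule.mkQ_apply, Submodule.mapQ_apply,
          LinearMap.add_apply]
        rw [← Submodule.Quotient.mk_add]
        congr 1
        ext
        simp
      map_smul' := by
        intro t x
        ext q
        simp only [LinearMap.comp_apply, Submodule.mkQ_apply, Submodule.mapQ_apply,
          LinearMap.smul_apply, RingHom.id_apply]
        rw [← Submodule.Quotient.mk_smul]
        congr 1
        ext
        simp }
  have hρmk (x) (q : W) : ρ x (U'.mkQ q) = U'.mkQ ⟨D x q, hWW x q q.2⟩ := rfl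
  have hρker (x) (hx : π x = 0) : ρ x = 0 := by
    ext q
    rw [LinearMap.comp_apply, hρmk]
    simpa [U'] using hWU x hx q.2
  have hρ (x y) : ρ (br x y) = ρ x * ρ y - ρ y * ρ x := by
    ext q
    simp only [LinearMap.comp_apply, LinearMap.sub_apply, Module.End.mul_apply, hρmk, ← map_sub]
    congr 1
    ext
    simp [hD]
  obtain ⟨s, hs⟩ := π.exists_rightInverse_of_surjective (LinearMap.range_eq_top.2 hsurj)
  replace hs (a) : π (s a) = a := LinearMap.congr_fun hs a
  have hρs (x y) (hxy : π x = π y) : ρ x = ρ y := by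
    rw [← sub_eq_zero, ← map_sub]
    exact hρker _ (by rw [map_sub, hxy, sub_self])
  obtain ⟨_, ⟨v, hv, rfl⟩, hinv⟩ := h.exists_invariant (ρ ∘ₗ s)
    (fun x y ↦ by
      simp only [LinearMap.comp_apply]
      rw [← hρ]
      exact hρs _ _ (by simp [hs, hπ]))
    ((V.comap W.subtype).map U'.mkQ)
    (by
      rintro x _ ⟨v, hv, rfl⟩
      exact ⟨_, hV (s x) v hv, rfl⟩)
    (U'.mkQ ⟨w, hwW⟩) (fun x ↦ ⟨⟨_, hWW (s x) _ hwW⟩, hw (s x), rfl⟩)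
  refine ⟨v, hv, fun x ↦ ?_⟩
  have := hinv (π x)
  rw [LinearMap.comp_apply, hρs (s (π x)) x (hs _), ← map_add, hρmk] at this
  simpa [U'] using this

theorem IsSimpleLieBracket.exists_proper_subalgebra_map_eq_top {F L S : Type*} [Field F]
    [CharZero F] [AddCommGroup L] [Module F L] [FiniteDimensional F L]
    [AddCommGroup S] [Module F S] [FiniteDimensional F S]
    {br : L →ₗ[F] L →ₗ[F] L} (hleib : ∀ x y z : L, br x (br y z) = br (br x y) z - br (br x z) y)
    {brS : S →ₗ[F] S →ₗ[F] S} (h : IsSimpleLieBracket brS)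
    (π : L →ₗ[F] S) (hsurj : Function.Surjective π) (hπ : ∀ x y, π (br x y) = brS (π x) (π y))
    (hab : ∀ a b, π a = 0 → π b = 0 → br a b = 0) (hne : LinearMap.ker π ≠ ⊥) :
    ∃ T : Submodule F L, Submodule.map₂ br T T ≤ T ∧ T ≠ ⊤ ∧ T.map π = ⊤ := by
  let R : L →ₗ[F] Module.End F L := br.flip
  have hRapp (x y) : R y x = br x y := rfl
  have hR (y z) : R (br y z) = R z * R y - R y * R z := by
    ext x
    simp [hRapp, hleib]
  let D : L →ₗ[F] Module.End F (Module.End F L) :=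
    LinearMap.mk₂ F (fun y φ ↦ φ * R y - R y * φ)
      (by intro a b φ; simp only [map_add]; noncomm_ring)
      (by intro t a φ; simp only [map_smul, mul_smul_comm, smul_mul_assoc, smul_sub])
      (by intro a φ ψ; noncomm_ring)
      (by intro t a φ; simp only [mul_smul_comm, smul_mul_assoc, smul_sub])
  have hDapp (y φ) : D y φ = φ * R y - R y * φ := rfl
  have hD (x y) : D (br x y) = D x * D y - D y * D x := by
    ext1 φ
    simp only [LinearMap.sub_apply, Module.End.mul_apply, hDapp, hR]
    noncomm_ring
  let M := LinearMap.ker π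
  have hM (x) : x ∈ M ↔ π x = 0 := LinearMap.mem_ker
  have hMl (x m) (hm : π m = 0) : π (br x m) = 0 := by simp [hπ, hm]
  have hMr (x m) (hm : π m = 0) : π (br m x) = 0 := by simp [hπ, hm]
  let V : Submodule F (Module.End F L) :=
    { carrier := {φ | (∀ x, π (φ x) = 0) ∧ ∀ m, π m = 0 → φ m = 0}
      add_mem' := by
        rintro φ ψ ⟨h1, h2⟩ ⟨h3, h4⟩
        exact ⟨fun x ↦ by simp [h1, h3], fun m hm ↦ by simp [h2 m hm, h4 m hm]⟩
      zero_mem' := by simp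
      smul_mem' := by
        rintro t φ ⟨h1, h2⟩
        exact ⟨fun x ↦ by simp [h1], fun m hm ↦ by simp [h2 m hm]⟩ }
  have hV (φ) : φ ∈ V ↔ (∀ x, π (φ x) = 0) ∧ ∀ m, π m = 0 → φ m = 0 := Iff.rfl
  obtain ⟨p, hp⟩ := M.subtype.exists_leftInverse_of_injective (Submodule.ker_subtype M)
  let φ₀ : Module.End F L := M.subtype ∘ₗ p
  have hφ₀ (x) : π (φ₀ x) = 0 := (p x).2
  have hφ₀M (m) (hm : π m = 0) : φ₀ m = m :=
    congrArg Subtype.val (LinearMap.congr_fun hp ⟨m, hm⟩)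
  have hDm (m) (hm : π m = 0) (φ : Module.End F L) (hφ : ∀ x, π (φ x) = 0) :
      D m φ = φ * R m := by
    ext x
    simp [hDapp, hRapp, hab _ _ (hφ x) hm]
  obtain ⟨v, hv, hinv⟩ := h.exists_invariant_mod π hsurj hπ D hD (M.map R) V
    (by
      rintro x _ ⟨m, hm, rfl⟩
      exact ⟨br x m, hMl x m hm, by rw [hDapp, hR]⟩)
    (by
      rintro x φ ⟨h1, h2⟩
      refine ⟨fun y ↦ ?_, fun m hm ↦ ?_⟩
      · simp [hDapp, hRapp, h1, hMr _ _ (h1 y)]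
      · simp [hDapp, hRapp, h2 _ (hMr x m hm), h2 m hm])
    (by
      rintro m hm φ ⟨h1, h2⟩
      rw [hDm m hm φ h1]
      have : φ * R m = 0 := by
        ext x
        simp [hRapp, h2 _ (hMl x m hm)]
      exact this ▸ zero_mem _)
    φ₀
    (by
      refine fun x ↦ ⟨fun y ↦ ?_, fun m hm ↦ ?_⟩
      · simp [hDapp, hRapp, hφ₀, hMr _ _ (hφ₀ y)]
      · simp [hDapp, hRapp, hφ₀M _ (hMr x m hm), hφ₀M m hm])
    (by
      intro m hm
      rw [hDm m hm φ₀ hφ₀]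
      refine ⟨m, hm, ?_⟩
      ext x
      simp [hRapp, hφ₀M _ (hMl x m hm)])
  let φ := φ₀ + v
  have hφ (x) : π (φ x) = 0 := by simp [φ, hφ₀, ((hV v).1 hv).1]
  have hφM (m) (hm : π m = 0) : φ m = m := by simp [φ, hφ₀M m hm, ((hV v).1 hv).2 m hm]
  have hDφ (m) (hm : π m = 0) : D m φ = R m := by
    rw [hDm m hm φ hφ]
    ext x
    simp [hRapp, hφM _ (hMl x m hm)]
  let T : Submodule F L := LinearMap.ker (D.flip φ)
  have hT (y) : y ∈ T ↔ D y φ = 0 := Iff.rfl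
  by_cases hTtop : T = ⊤
  · refine ⟨LinearMap.ker φ, ?_, ?_, ?_⟩
    · refine Submodule.map₂_le.2 fun a ha b _ ↦ ?_
      have := LinearMap.congr_fun ((hT b).1 (hTtop ▸ Submodule.mem_top)) a
      simp only [hDapp, LinearMap.sub_apply, Module.End.mul_apply, hRapp,
        LinearMap.mem_ker.1 ha, map_zero, LinearMap.zero_apply, sub_zero] at this
      exact this
    · rintro htop
      refine hne ((Submodule.eq_bot_iff _).2 fun m hm ↦ ?_)
      rw [← hφM m hm]
      exact LinearMap.mem_ker.1 (htop ▸ Submodule.mem_top)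
    · refine top_unique fun a _ ↦ ?_
      obtain ⟨x, rfl⟩ := hsurj a
      exact ⟨x - φ x, by simp [hφM _ (hφ x)], by simp [hφ]⟩
  · refine ⟨T, ?_, hTtop, ?_⟩
    · refine Submodule.map₂_le.2 fun a ha b hb ↦ ?_
      rw [hT] at ha hb ⊢
      simp [hD, ha, hb]
    · refine top_unique fun a _ ↦ ?_
      obtain ⟨x, rfl⟩ := hsurj a
      obtain ⟨m, hm, hmx⟩ := hinv x
      refine ⟨x - m, ?_, by simp [(hM m).1 hm]⟩
      change D (x - m) φ = 0
      rw [map_sub, LinearMap.sub_apply, hDφ m hm, hmx, sub_self]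

theorem Submodule.map_map₂_of_hom {F L S : Type*} [Field F] [AddCommGroup L] [Module F L]
    [AddCommGroup S] [Module F S] {br : L →ₗ[F] L →ₗ[F] L} {brS : S →ₗ[F] S →ₗ[F] S}
    {π : L →ₗ[F] S} (hπ : ∀ x y, π (br x y) = brS (π x) (π y)) (T T' : Submodule F L) :
    (Submodule.map₂ br T T').map π = Submodule.map₂ brS (T.map π) (T'.map π) := by
  refine le_antisymm ?_ (Submodule.map₂_le.2 ?_)
  · rw [Submodule.map_le_iff_le_comap, Submodule.map₂_le]
    intro a ha b hb
    rw [Submodule.mem_comap, hπ]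
    exact Submodule.apply_mem_map₂ _ (Submodule.mem_map_of_mem ha) (Submodule.mem_map_of_mem hb)
  · rintro _ ⟨a, ha, rfl⟩ _ ⟨b, hb, rfl⟩
    rw [← hπ]
    exact Submodule.mem_map_of_mem (Submodule.apply_mem_map₂ _ ha hb)

theorem exists_perfect_le_map_eq {F L S : Type*} [Field F] [AddCommGroup L] [Module F L]
    [FiniteDimensional F L] [AddCommGroup S] [Module F S]
    {br : L →ₗ[F] L →ₗ[F] L} {brS : S →ₗ[F] S →ₗ[F] S}
    (π : L →ₗ[F] S) (hπ : ∀ x y, π (br x y) = brS (π x) (π y))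
    (T : Submodule F L) (hT : Submodule.map₂ br T T ≤ T)
    (hmap : Submodule.map₂ brS (T.map π) (T.map π) = T.map π) :
    ∃ D ≤ T, Submodule.map₂ br D D = D ∧ D.map π = T.map π := by
  obtain ⟨D, ⟨hDT, hD, hDmap⟩, hmin⟩ := (wellFounded_lt (α := Submodule F L)).has_min
    {D | D ≤ T ∧ Submodule.map₂ br D D ≤ D ∧ D.map π = T.map π} ⟨T, le_rfl, hT, rfl⟩
  refine ⟨D, hDT, hD.eq_or_lt.resolve_right fun hlt ↦ hmin _ ⟨hD.trans hDT, ?_, ?_⟩ hlt, hDmap⟩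
  · exact Submodule.map₂_le_map₂ hD hD
  · rw [Submodule.map_map₂_of_hom hπ, hDmap, hmap]

theorem exists_restrict_bracket {F L : Type*} [Field F] [AddCommGroup L] [Module F L]
    (br : L →ₗ[F] L →ₗ[F] L) (T : Submodule F L) (hT : Submodule.map₂ br T T ≤ T) :
    ∃ brT : T →ₗ[F] T →ₗ[F] T, ∀ x y, (brT x y : L) = br x y :=
  ⟨LinearMap.mk₂ F (fun x y : T ↦ ⟨br x y, hT (Submodule.apply_mem_map₂ _ x.2 y.2)⟩)
    (by intros; ext; simp) (by intros; ext; simp) (by intros; ext; simp) (by intros; ext; simp),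
    fun _ _ ↦ rfl⟩

theorem exists_quotient_bracket {F L : Type*} [Field F] [AddCommGroup L] [Module F L]
    (br : L →ₗ[F] L →ₗ[F] L) (J : Submodule F L)
    (hJ : ∀ a ∈ J, ∀ x, br a x ∈ J ∧ br x a ∈ J) :
    ∃ brQ : (L ⧸ J) →ₗ[F] (L ⧸ J) →ₗ[F] (L ⧸ J),
      ∀ x y, J.mkQ (br x y) = brQ (J.mkQ x) (J.mkQ y) := by
  let f : L →ₗ[F] Module.End F (L ⧸ J) :=
    { toFun := fun x ↦ J.mapQ J (br x) fun a ha ↦ (hJ a ha x).2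
      map_add' := by intros; ext; simp
      map_smul' := by intros; ext; simp }
  refine ⟨J.liftQ f fun a ha ↦ ?_, fun x y ↦ rfl⟩
  rw [LinearMap.mem_ker]
  ext x
  simpa [f] using (hJ a ha x).1

theorem exists_perfect_ne_bot {F L : Type*} [Field F] [AddCommGroup L] [Module F L]
    [FiniteDimensional F L] (br : L →ₗ[F] L →ₗ[F] L) (h : ∀ n, derSeries br n ≠ ⊥) :
    ∃ D : Submodule F L, D ≠ ⊥ ∧ Submodule.map₂ br D D = D := by
  have hsucc (n) : derSeries br (n + 1) = Submodule.map₂ br (derSeries br n) (derSeries br n) := by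
    refine le_antisymm (Submodule.span_le.2 ?_) (Submodule.map₂_le.2 ?_)
    · rintro _ ⟨u, hu, v, hv, rfl⟩
      exact Submodule.apply_mem_map₂ _ hu hv
    · exact fun u hu v hv ↦ Submodule.subset_span ⟨u, hu, v, hv, rfl⟩
  have hle (n) : derSeries br (n + 1) ≤ derSeries br n := by
    induction n with
    | zero => exact le_top
    | succ n ih =>
      rw [hsucc (n + 1)]
      conv_rhs => rw [hsucc n]
      exact Submodule.map₂_le_map₂ ih ih
  obtain ⟨_, ⟨n, rfl⟩, hmin⟩ := (wellFounded_lt (α := Submodule F L)).has_min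
    (Set.range (derSeries br)) (Set.range_nonempty _)
  exact ⟨_, h n, by
    rw [← hsucc]
    exact (hle n).eq_or_lt.resolve_right (hmin _ ⟨n + 1, rfl⟩)⟩

theorem isSimpleLieBracket_of_forall_ideal {F L : Type*} [Field F] [AddCommGroup L] [Module F L]
    [Nontrivial L] {br : L →ₗ[F] L →ₗ[F] L}
    (hleib : ∀ x y z : L, br x (br y z) = br (br x y) z - br (br x z) y)
    (hperf : Submodule.map₂ br ⊤ ⊤ = ⊤)
    (hideal : ∀ J : Submodule F L, (∀ a ∈ J, ∀ x, br a x ∈ J ∧ br x a ∈ J) → J = ⊥ ∨ J = ⊤) :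
    IsSimpleLieBracket br := by
  let I : Submodule F L := Submodule.span F (Set.range fun x ↦ br x x)
  have hsq (x) : br x x ∈ I := Submodule.subset_span ⟨x, rfl⟩
  have hleft (y) : ∀ a ∈ I, br y a = 0 := by
    have : I ≤ LinearMap.ker (br y) := by
      refine Submodule.span_le.2 ?_
      rintro _ ⟨x, rfl⟩
      simp [hleib]
    exact this
  have hpol (x y) : br x y + br y x ∈ I := by
    have := sub_mem (sub_mem (hsq (x + y)) (hsq x)) (hsq y)
    simp only [map_add, LinearMap.add_apply] at this
    convert this using 1
    abel
  have hright (y) : ∀ a ∈ I, br a y ∈ I := by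
    have : I ≤ I.comap (br.flip y) := by
      refine Submodule.span_le.2 ?_
      rintro _ ⟨x, rfl⟩
      have := hpol x (br x y)
      rwa [hleib, sub_add_cancel] at this
    exact this
  have hI : I = ⊥ := by
    refine (hideal I fun a ha x ↦ ⟨hright x a ha, hleft x a ha ▸ zero_mem _⟩).resolve_right ?_
    intro htop
    refine bot_ne_top (α := Submodule F L) (hperf ▸ (eq_bot_iff.2 (Submodule.map₂_le.2 ?_)).symm)
    intro y _ a _
    exact hleft y a (htop ▸ Submodule.mem_top)
  have hself (x) : br x x = 0 := by simpa [hI] using hsq x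
  refine ⟨hleib, hself, hperf, inferInstance, fun J hJ ↦ hideal J fun a ha x ↦ ⟨hJ a ha x, ?_⟩⟩
  rw [apply_eq_neg_apply_of_self_eq_zero hself]
  exact neg_mem (hJ a ha x)

theorem exists_isSimpleLieBracket_quotient {F L S : Type*} [Field F] [AddCommGroup L] [Module F L]
    [FiniteDimensional F L] {br : L →ₗ[F] L →ₗ[F] L}
    (hmin : ∀ D : Submodule F L, Submodule.map₂ br D D = D → D = ⊥ ∨ D = ⊤)
    {J : Submodule F L} {brQ : (L ⧸ J) →ₗ[F] (L ⧸ J) →ₗ[F] (L ⧸ J)}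
    (hQ : ∀ x y, J.mkQ (br x y) = brQ (J.mkQ x) (J.mkQ y))
    [AddCommGroup S] [Module F S] {brS : S →ₗ[F] S →ₗ[F] S} (hS : IsSimpleLieBracket brS)
    (f : S →ₗ[F] (L ⧸ J)) (hinj : Function.Injective f)
    (hf : ∀ x y, f (brS x y) = brQ (f x) (f y)) :
    ∃ π : L →ₗ[F] S, Function.Surjective π ∧ (∀ x y, π (br x y) = brS (π x) (π y)) ∧
      LinearMap.ker π = J := by
  have hmap : ((LinearMap.range f).comap J.mkQ).map J.mkQ = LinearMap.range f :=
    Submodule.map_comap_eq_of_surjective J.mkQ_surjective _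
  have hperf : Submodule.map₂ brQ (LinearMap.range f) (LinearMap.range f) = LinearMap.range f := by
    rw [LinearMap.range_eq_map, ← Submodule.map_map₂_of_hom hf, hS.perfect]
  obtain ⟨D, -, hD, hDmap⟩ := exists_perfect_le_map_eq J.mkQ hQ ((LinearMap.range f).comap J.mkQ)
    (by rw [← Submodule.map_le_iff_le_comap, Submodule.map_map₂_of_hom hQ, hmap, hperf])
    (by rw [hmap, hperf])
  rw [hmap] at hDmap
  have hsurj : Function.Surjective f := by
    rw [← LinearMap.range_eq_top]
    rcases hmin D hD with rfl | rfl
    · rw [Submodule.map_bot] at hDmap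
      have := hS.nontrivial
      obtain ⟨x, hx⟩ := exists_ne (0 : S)
      refine absurd (hinj ?_) hx
      rw [map_zero, ← Submodule.mem_bot F, hDmap]
      exact LinearMap.mem_range_self f x
    · rw [← hDmap, Submodule.map_top, Submodule.range_mkQ]
  let e := LinearEquiv.ofBijective f ⟨hinj, hsurj⟩
  have hfe (q) : f (e.symm q) = q := e.apply_symm_apply q
  refine ⟨e.symm.toLinearMap ∘ₗ J.mkQ, e.symm.surjective.comp J.mkQ_surjective, ?_, ?_⟩
  · intro x y
    apply hinj
    simp only [LinearMap.comp_apply, LinearEquiv.coe_coe, hf, hfe, hQ]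
  · rw [LinearEquiv.ker_comp, Submodule.ker_mkQ]

/-- A nonzero finite-dimensional perfect Leibniz algebra in characteristic zero contains a simple
Lie algebra. -/
theorem exists_isSimpleLieBracket_injective {F : Type*} [Field F] [CharZero F] {L : Type u}
    [AddCommGroup L] [Module F L] [FiniteDimensional F L] [Nontrivial L]
    (br : L →ₗ[F] L →ₗ[F] L) (hleib : ∀ x y z : L, br x (br y z) = br (br x y) z - br (br x z) y)
    (hperf : Submodule.map₂ br ⊤ ⊤ = ⊤) :
    ∃ (S : Type u) (_ : AddCommGroup S) (_ : Module F S) (brS : S →ₗ[F] S →ₗ[F] S)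
      (f : S →ₗ[F] L), IsSimpleLieBracket brS ∧ Function.Injective f ∧
        ∀ x y, f (brS x y) = br (f x) (f y) := by
  induction hn : Module.finrank F L using Nat.strong_induction_on generalizing L with
  | _ n ih =>
  by_contra hno
  have hmin (D : Submodule F L) (hD : Submodule.map₂ br D D = D) : D = ⊥ ∨ D = ⊤ := by
    by_contra! hcon
    obtain ⟨brD, hbrD⟩ := exists_restrict_bracket br D hD.le
    have : Nontrivial D := Submodule.nontrivial_iff_ne_bot.2 hcon.1
    obtain ⟨S, _, _, brS, f, hS, hf, hfhom⟩ := ih _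
      (hn ▸ Submodule.finrank_lt hcon.2) brD
      (by intro x y z; ext; simp [hbrD, hleib])
      (by
        apply Submodule.map_injective_of_injective D.injective_subtype
        rw [Submodule.map_map₂_of_hom (brS := br) hbrD, Submodule.map_subtype_top, hD])
      rfl
    exact hno ⟨S, _, _, brS, D.subtype ∘ₗ f, hS, D.injective_subtype.comp hf,
      fun x y ↦ by simp [hfhom, hbrD]⟩
  have hquot (J : Submodule F L) (hJ : ∀ a ∈ J, ∀ x, br a x ∈ J ∧ br x a ∈ J) (hbot : J ≠ ⊥)
      (htop : J ≠ ⊤) : ∃ (S : Type u) (_ : AddCommGroup S) (_ : Module F S)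
        (brS : S →ₗ[F] S →ₗ[F] S) (π : L →ₗ[F] S), IsSimpleLieBracket brS ∧
        Function.Surjective π ∧ (∀ x y, π (br x y) = brS (π x) (π y)) ∧ LinearMap.ker π = J := by
    obtain ⟨brQ, hQ⟩ := exists_quotient_bracket br J hJ
    have : Nontrivial (L ⧸ J) := Submodule.Quotient.nontrivial_iff.2 htop
    obtain ⟨S, _, _, brS, f, hS, hf, hfhom⟩ := ih _
      (by
        rw [← hn, ← J.finrank_quotient_add_finrank]
        have := Submodule.one_le_finrank_iff.2 hbot
        omega) brQ
      (by
        intro x y z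
        obtain ⟨x, rfl⟩ := J.mkQ_surjective x
        obtain ⟨y, rfl⟩ := J.mkQ_surjective y
        obtain ⟨z, rfl⟩ := J.mkQ_surjective z
        simp only [← hQ, ← map_sub, hleib])
      (by
        have := Submodule.map_map₂_of_hom hQ ⊤ ⊤
        rwa [hperf, Submodule.map_top, Submodule.range_mkQ, eq_comm] at this)
      rfl
    obtain ⟨π, hπ⟩ := exists_isSimpleLieBracket_quotient hmin hQ hS f hf hfhom
    exact ⟨S, _, _, brS, π, hS, hπ⟩
  by_cases hideal : ∀ J : Submodule F L, (∀ a ∈ J, ∀ x, br a x ∈ J ∧ br x a ∈ J) → J = ⊥ ∨ J = ⊤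
  · exact hno ⟨L, _, _, br, LinearMap.id, isSimpleLieBracket_of_forall_ideal hleib hperf hideal,
      Function.injective_id, fun _ _ ↦ rfl⟩
  push Not at hideal
  obtain ⟨M, hM, hbot, htop⟩ := hideal
  have hMM : Submodule.map₂ br M M ≤ M := Submodule.map₂_le.2 fun a ha b _ ↦ (hM a ha b).1
  have hMM_ideal : ∀ a ∈ Submodule.map₂ br M M, ∀ x,
      br a x ∈ Submodule.map₂ br M M ∧ br x a ∈ Submodule.map₂ br M M := by
    intro c hc x
    have hr : Submodule.map₂ br M M ≤ (Submodule.map₂ br M M).comap (br.flip x) := by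
      refine Submodule.map₂_le.2 fun a ha b hb ↦ ?_
      have := add_mem (Submodule.apply_mem_map₂ br ha (hM b hb x).1)
        (Submodule.apply_mem_map₂ br (hM a ha x).1 hb)
      rwa [hleib, sub_add_cancel] at this
    have hl : Submodule.map₂ br M M ≤ (Submodule.map₂ br M M).comap (br x) := by
      refine Submodule.map₂_le.2 fun a ha b hb ↦ ?_
      rw [Submodule.mem_comap, hleib]
      exact sub_mem (Submodule.apply_mem_map₂ br (hM a ha x).2 hb)
        (Submodule.apply_mem_map₂ br (hM b hb x).2 ha)
    exact ⟨hr hc, hl hc⟩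
  have hMM_ne : Submodule.map₂ br M M ≠ M := fun h ↦ (hmin M h).elim hbot htop
  have hMM_bot : Submodule.map₂ br M M = ⊥ := by
    by_contra hne
    obtain ⟨S, _, _, brS, π, hS, hsurj, hπ, hker⟩ := hquot _ hMM_ideal hne
      fun h ↦ htop (top_unique (h ▸ hMM))
    rcases hS.simple (M.map π) (by
      rintro _ ⟨a, ha, rfl⟩ y
      obtain ⟨x, rfl⟩ := hsurj y
      exact ⟨_, (hM a ha x).1, hπ a x⟩) with h | h
    · refine hMM_ne (le_antisymm hMM ?_)
      rw [← hker]
      intro a ha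
      have := Submodule.mem_map_of_mem (f := π) ha
      rw [h, Submodule.mem_bot] at this
      exact LinearMap.mem_ker.2 this
    · refine htop (top_unique fun x _ ↦ ?_)
      obtain ⟨a, ha, hax⟩ : π x ∈ M.map π := h ▸ Submodule.mem_top
      have : x - a ∈ LinearMap.ker π := by simp [hax]
      rw [hker] at this
      simpa using add_mem (hMM this) ha
  obtain ⟨S, _, _, brS, π, hS, hsurj, hπ, hker⟩ := hquot M hM hbot htop
  have : FiniteDimensional F S := Module.Finite.of_surjective π hsurj
  obtain ⟨T, hT, hTtop, hTmap⟩ := hS.exists_proper_subalgebra_map_eq_top hleib π hsurj hπ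
    (fun a b ha hb ↦ by
      rw [← LinearMap.mem_ker, hker] at ha hb
      rw [← Submodule.mem_bot F, ← hMM_bot]
      exact Submodule.apply_mem_map₂ br ha hb)
    (hker ▸ hbot)
  obtain ⟨D, hDT, hD, hDmap⟩ := exists_perfect_le_map_eq π hπ T hT (by rw [hTmap, hS.perfect])
  rcases hmin D hD with rfl | rfl
  · have := hS.nontrivial
    rw [Submodule.map_bot, hTmap] at hDmap
    exact bot_ne_top hDmap
  · exact hTtop (top_unique hDT)

theorem IsSimpleLieBracket.exists_engel_two_ne_zero {F S : Type*} [Field F] [CharZero F]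
    [AddCommGroup S] [Module F S] {br : S →ₗ[F] S →ₗ[F] S} (h : IsSimpleLieBracket br) :
    ∃ x a, br x (br x a) ≠ 0 := by
  by_contra! hE
  have hskew := apply_eq_neg_apply_of_self_eq_zero h.self
  have hcomm (x y a) : br x (br y a) = br (br a y) x := by
    rw [hskew x (br y a), hskew y a]
    simp
  have hswap (x y a) : br (br a x) y = - br (br a y) x := by
    have := hE (x + y) a
    simp only [map_add, LinearMap.add_apply, hE, zero_add, add_zero, hcomm] at this
    exact eq_neg_of_add_eq_zero_left this
  have h3 (x y z) : br (br x y) z = 0 := by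
    have h1 := h.leibniz x y z
    have h2 : br x (br y z) = - br (br x y) z := by
      rw [hskew x (br y z), hswap z x y, hskew y x]
      simp
    rw [h2, hswap z y x] at h1
    have : (3 : F) • br (br x y) z = 0 := by linear_combination (norm := module) (-1 : F) • h1
    simpa using this
  have hbr (x y) : br x y = 0 := by
    have : (⊤ : Submodule F S) ≤ LinearMap.ker (br.flip y) := by
      rw [← h.perfect]
      exact Submodule.map₂_le.2 fun a _ b _ ↦ h3 a b y
    exact this (Submodule.mem_top (x := x))
  have := h.nontrivial
  refine bot_ne_top (α := Submodule F S) ?_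
  rw [← h.perfect, eq_comm, eq_bot_iff, Submodule.map₂_le]
  intro x _ y _
  exact hbr x y

/-- A finite-dimensional (right) Leibniz algebra over a field of
characteristic zero in which every centralizer
`C_L(x) = {y | [x,y] = [y,x] = 0}` is a two-sided ideal is solvable. -/
theorem stmt_15 (F : Type*) [Field F] [CharZero F]
    (L : Type*) [AddCommGroup L] [Module F L] [FiniteDimensional F L]
    (br : L →ₗ[F] L →ₗ[F] L)
    (hleib : ∀ x y z : L, br x (br y z) = br (br x y) z - br (br x z) y)
    (hCL : ∀ x y : L, br x y = 0 → br y x = 0 → ∀ a : L,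
      (br x (br y a) = 0 ∧ br (br y a) x = 0) ∧
        (br x (br a y) = 0 ∧ br (br a y) x = 0)) :
    ∃ n : ℕ, derSeries br n = ⊥ := by
  by_contra! hn
  obtain ⟨D, hbot, hD⟩ := exists_perfect_ne_bot br hn
  obtain ⟨brD, hbrD⟩ := exists_restrict_bracket br D hD.le
  have : Nontrivial D := Submodule.nontrivial_iff_ne_bot.2 hbot
  obtain ⟨S, _, _, brS, f, hS, hf, hfhom⟩ := exists_isSimpleLieBracket_injective brD
    (by intro x y z; ext; simp [hbrD, hleib])
    (by
      apply Submodule.map_injective_of_injective D.injective_subtype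
      rw [Submodule.map_map₂_of_hom (brS := br) hbrD, Submodule.map_subtype_top, hD])
  obtain ⟨x, a, hxa⟩ := hS.exists_engel_two_ne_zero
  refine hxa (hf (D.injective_subtype ?_))
  have hx : br (f x : L) (f x) = 0 := by rw [← hbrD, ← hfhom, hS.self]; simp
  simpa [hfhom, hbrD] using (hCL _ _ hx hx (f a)).1.1
end

section
/- Let L be a finite-dimensional (right) Leibniz algebra over a field F such that the centralizer C_L(x) is a two-sided ideal of L for every x ∈ L, and suppose L is φ-free, i.e., the only two-sided ideal of L contained in every maximal subalgebra of L is 0. Then L^{(3)} = 0. -/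
/-- A subspace `S` is a subalgebra if it is closed under the bracket. -/
def IsSubalg {F L : Type*} [Field F] [AddCommGroup L] [Module F L]
    (br : L →ₗ[F] L →ₗ[F] L) (S : Submodule F L) : Prop :=
  ∀ u ∈ S, ∀ v ∈ S, br u v ∈ S

/-- A subalgebra is maximal if it is proper and not properly contained in any
proper subalgebra. -/
def IsMaxSubalg {F L : Type*} [Field F] [AddCommGroup L] [Module F L]
    (br : L →ₗ[F] L →ₗ[F] L) (S : Submodule F L) : Prop :=
  IsSubalg br S ∧ S ≠ ⊤ ∧
    ∀ T : Submodule F L, IsSubalg br T → S ≤ T → T = S ∨ T = ⊤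

/-- An algebra with an anticommutative bracket satisfying the Leibniz identity and the 2-Engel
identity `[[x,y],y] = 0` is metabelian; here everything takes place inside a subalgebra `B`. -/
theorem br_br_br_eq_zero_of_engel {F L : Type*} [Field F] [AddCommGroup L] [Module F L]
    (br : L →ₗ[F] L →ₗ[F] L)
    (hleib : ∀ x y z : L, br x (br y z) = br (br x y) z - br (br x z) y)
    (B : Submodule F L) (hB : IsSubalg br B)
    (hanti : ∀ x ∈ B, ∀ y ∈ B, br x y = -br y x)
    (hengel : ∀ x ∈ B, ∀ y ∈ B, br (br x y) y = 0)
    {x y z w : L} (hx : x ∈ B) (hy : y ∈ B) (hz : z ∈ B) (hw : w ∈ B) :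
    br (br x y) (br z w) = 0 := by
  have swap : ∀ a ∈ B, ∀ b ∈ B, ∀ c ∈ B, br (br a b) c = -br (br a c) b := by
    intro a ha b hb c hc
    have h := hengel a ha (b + c) (B.add_mem hb hc)
    simp only [map_add, LinearMap.add_apply, hengel a ha b hb, hengel a ha c hc] at h
    rw [zero_add, add_zero] at h
    rw [eq_neg_iff_add_eq_zero, add_comm]
    exact h
  have flip : ∀ a ∈ B, ∀ b ∈ B, ∀ c, br (br a b) c = -br (br b a) c := by
    intro a ha b hb c
    rw [hanti a ha b hb, map_neg, LinearMap.neg_apply]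
  have three : ∀ a ∈ B, ∀ b ∈ B, ∀ c ∈ B, (3 : ℤ) • br (br a b) c = 0 := by
    intro a ha b hb c hc
    have h1 := hleib a b c
    rw [hanti a ha _ (hB b hb c hc), swap a ha c hc b hb, flip b hb c hc, swap c hc b hb a ha,
      flip c hc a ha, swap a ha c hc b hb] at h1
    simp only [neg_neg] at h1
    have h2 : (3 : ℤ) • br (br a b) c
        = (br (br a b) c - -br (br a b) c) - -br (br a b) c := by module
    rw [h2, ← h1]
    module
  have hxy := hB x hx y hy
  have hzw := hB z hz w hw
  have rot : br (br (br z w) x) y = br (br (br x y) z) w := by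
    rw [swap z hz w hw x hx, flip z hz x hx]
    simp only [neg_neg]
    rw [swap _ (hB x hx z hz) w hw y hy, swap x hx z hz y hy]
    simp only [map_neg, LinearMap.neg_apply, neg_neg]
  have h1 := hleib (br x y) z w
  rw [swap _ hxy w hw z hz] at h1
  have h2 := hleib (br z w) x y
  rw [swap _ hzw y hy x hx, rot] at h2
  have h3 := hanti _ hxy _ hzw
  have h4 := three _ hxy z hz w hw
  generalize br (br (br x y) z) w = g at *
  generalize br (br x y) (br z w) = p at *
  generalize br (br z w) (br x y) = q at *
  have h5 : g = (p + q) - (3 : ℤ) • g := by rw [h1, h2]; module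
  rw [h3, h4, neg_add_cancel, sub_zero] at h5
  rw [h1, h5]
  simp

/-- In a `φ`-free algebra every ideal with zero multiplication is complemented by a
subalgebra. -/
theorem exists_isSubalg_isCompl {F L : Type*} [Field F] [AddCommGroup L] [Module F L]
    [FiniteDimensional F L] (br : L →ₗ[F] L →ₗ[F] L)
    (hphi : ∀ I : Submodule F L,
      (∀ y ∈ I, ∀ a : L, br y a ∈ I ∧ br a y ∈ I) →
      (∀ S : Submodule F L, IsMaxSubalg br S → I ≤ S) → I = ⊥)
    (A : Submodule F L) (hA : ∀ y ∈ A, ∀ a : L, br y a ∈ A ∧ br a y ∈ A)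
    (hAA : ∀ x ∈ A, ∀ y ∈ A, br x y = 0) :
    ∃ B : Submodule F L, IsSubalg br B ∧ IsCompl A B := by
  obtain ⟨B, ⟨hB, hAB⟩, hmin⟩ := (wellFounded_lt (α := Submodule F L)).has_min
    {B | IsSubalg br B ∧ A ⊔ B = ⊤} ⟨⊤, fun _ _ _ _ => trivial, by simp⟩
  refine ⟨B, hB, disjoint_iff.2 ?_, codisjoint_iff.2 hAB⟩
  have hI : ∀ y ∈ A ⊓ B, ∀ a : L, br y a ∈ A ⊓ B ∧ br a y ∈ A ⊓ B := by
    rintro y ⟨hyA, hyB⟩ c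
    refine ⟨⟨(hA y hyA c).1, ?_⟩, ⟨(hA y hyA c).2, ?_⟩⟩ <;>
    · obtain ⟨a, ha, b, hb, rfl⟩ := Submodule.mem_sup.1 (hAB ▸ Submodule.mem_top : c ∈ A ⊔ B)
      simp only [map_add, LinearMap.add_apply, hAA y hyA a ha, hAA a ha y hyA, zero_add]
      first | exact hB _ hyB _ hb | exact hB _ hb _ hyB
  refine hphi _ hI fun S ⟨hS, _, hSmax⟩ => ?_
  have hT : IsSubalg br (A ⊓ B ⊔ S) := by
    intro u hu v hv
    obtain ⟨i, hi, s, hs, rfl⟩ := Submodule.mem_sup.1 hu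
    rw [map_add, LinearMap.add_apply]
    refine add_mem (Submodule.mem_sup_left (hI i hi v).1) ?_
    obtain ⟨j, hj, t, ht, rfl⟩ := Submodule.mem_sup.1 hv
    rw [map_add]
    exact add_mem (Submodule.mem_sup_left (hI j hj s).2) (Submodule.mem_sup_right (hS s hs t ht))
  rcases hSmax _ hT le_sup_right with h | h
  · exact h ▸ le_sup_left
  · have hmem : S ⊓ B ∈ {B | IsSubalg br B ∧ A ⊔ B = ⊤} := by
      refine ⟨fun u hu v hv => ⟨hS u hu.1 v hv.1, hB u hu.2 v hv.2⟩, eq_top_iff.2 ?_⟩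
      rw [← hAB]
      refine sup_le le_sup_left fun b hb => ?_
      obtain ⟨i, hi, s, hs, rfl⟩ :=
        Submodule.mem_sup.1 (h ▸ Submodule.mem_top : b ∈ A ⊓ B ⊔ S)
      exact add_mem (Submodule.mem_sup_left hi.1)
        (Submodule.mem_sup_right ⟨hs, (B.add_mem_iff_right hi.2).1 hb⟩)
    have hBS : B ≤ S := by
      by_contra hc
      exact hmin _ hmem (lt_of_le_of_ne inf_le_right fun he => hc (inf_eq_right.1 he))
    exact inf_le_right.trans hBS

/-- A bilinear map sending `S × S` into a subspace `A` sends `span S × span S` into `A`. -/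
theorem br_mem_of_mem_span {F L : Type*} [Field F] [AddCommGroup L] [Module F L]
    (br : L →ₗ[F] L →ₗ[F] L) {S : Set L} {A : Submodule F L}
    (h : ∀ s ∈ S, ∀ t ∈ S, br s t ∈ A) {u v : L}
    (hu : u ∈ Submodule.span F S) (hv : v ∈ Submodule.span F S) : br u v ∈ A := by
  have hle : Submodule.map₂ br (Submodule.span F S) (Submodule.span F S) ≤ A := by
    rw [Submodule.map₂_span_span, Submodule.span_le]
    rintro _ ⟨s, hs, t, ht, rfl⟩
    exact h s hs t ht
  exact hle (Submodule.apply_mem_map₂ br hu hv)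

/-- A finite-dimensional (right) Leibniz algebra in which every centralizer
is a two-sided ideal and which is φ-free (the only two-sided ideal contained
in every maximal subalgebra is `0`) satisfies `L⁽³⁾ = 0`. -/
theorem stmt_16 (F : Type*) [Field F]
    (L : Type*) [AddCommGroup L] [Module F L] [FiniteDimensional F L]
    (br : L →ₗ[F] L →ₗ[F] L)
    (hleib : ∀ x y z : L, br x (br y z) = br (br x y) z - br (br x z) y)
    (hCL : ∀ x y : L, br x y = 0 → br y x = 0 → ∀ a : L,
      (br x (br y a) = 0 ∧ br (br y a) x = 0) ∧
        (br x (br a y) = 0 ∧ br (br a y) x = 0))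
    (hphi : ∀ I : Submodule F L,
      (∀ y ∈ I, ∀ a : L, br y a ∈ I ∧ br a y ∈ I) →
      (∀ S : Submodule F L, IsMaxSubalg br S → I ≤ S) → I = ⊥) :
    derSeries br 3 = ⊥ := by
  let A : Submodule F L := LinearMap.ker br.flip
  have memA : ∀ {a : L}, a ∈ A ↔ ∀ x, br x a = 0 := by
    intro a
    simp [A, LinearMap.mem_ker, LinearMap.ext_iff]
  have hA : ∀ y ∈ A, ∀ a : L, br y a ∈ A ∧ br a y ∈ A := by
    intro y hy a
    rw [memA] at hy
    refine ⟨memA.2 fun x => ?_, ?_⟩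
    · rw [hleib, hy, hy, map_zero, LinearMap.zero_apply, sub_zero]
    · rw [hy]
      exact A.zero_mem
  obtain ⟨B, hB, hAB⟩ := exists_isSubalg_isCompl br hphi A hA fun x _ y hy => memA.1 hy x
  have hsq : ∀ b ∈ B, br b b = 0 := fun b hb =>
    (Submodule.disjoint_def.1 hAB.disjoint) _
      (memA.2 fun x => by rw [hleib, sub_self]) (hB b hb b hb)
  have hanti : ∀ x ∈ B, ∀ y ∈ B, br x y = -br y x := by
    intro x hx y hy
    have h := hsq _ (B.add_mem hx hy)
    simp only [map_add, LinearMap.add_apply, hsq x hx, hsq y hy] at h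
    rw [zero_add, add_zero] at h
    rw [eq_neg_iff_add_eq_zero, add_comm]
    exact h
  have hengel : ∀ x ∈ B, ∀ y ∈ B, br (br x y) y = 0 := fun x _ y hy =>
    (hCL y y (hsq y hy) (hsq y hy) x).2.2
  have decomp : ∀ x : L, ∃ b ∈ B, x - b ∈ A := by
    intro x
    obtain ⟨a, ha, b, hb, rfl⟩ := Submodule.mem_sup.1
      (hAB.sup_eq_top ▸ Submodule.mem_top : x ∈ A ⊔ B)
    exact ⟨b, hb, by simpa using ha⟩
  have hcongr : ∀ x y b c : L, x - b ∈ A → y - c ∈ A → br x y - br b c ∈ A := by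
    intro x y b c hx hy
    have h : br x y - br b c = br (x - b) y + br b (y - c) := by
      simp only [map_sub, LinearMap.sub_apply]
      abel
    rw [h]
    exact A.add_mem (hA _ hx y).1 (hA _ hy b).2
  have hmeta : ∀ x y z w : L, br (br x y) (br z w) ∈ A := by
    intro x y z w
    obtain ⟨x', hx, hx'⟩ := decomp x
    obtain ⟨y', hy, hy'⟩ := decomp y
    obtain ⟨z', hz, hz'⟩ := decomp z
    obtain ⟨w', hw, hw'⟩ := decomp w
    have h := hcongr _ _ _ _ (hcongr _ _ _ _ hx' hy') (hcongr _ _ _ _ hz' hw')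
    rwa [br_br_br_eq_zero_of_engel br hleib B hB hanti hengel hx hy hz hw, sub_zero] at h
  have h2 : derSeries br 2 ≤ A := by
    refine Submodule.span_le.2 ?_
    rintro _ ⟨u, hu, v, hv, rfl⟩
    refine br_mem_of_mem_span br ?_ hu hv
    rintro _ ⟨x, _, y, _, rfl⟩ _ ⟨z, _, w, _, rfl⟩
    exact hmeta x y z w
  refine (Submodule.span_eq_bot).2 ?_
  rintro _ ⟨u, _, v, hv, rfl⟩
  exact memA.1 (h2 hv) u
end
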